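/- Let (A_1,…,A_ℓ) be invertible d×d real matrices such that for every positive integer t dividing d the cocycle 𝒜^t is irreducible (no subspace V of ℝ^d with V ≠ {0} and V ≠ ℝ^d satisfies A_I V ⊆ V for every word I of length t), and for every 1 ≤ m ≤ d−1 the cocycle 𝒜^{∧m} is irreducible (no subspace W of ⋀^m ℝ^d with W ≠ {0} and W ≠ ⋀^m ℝ^d satisfies (⋀^m A_i) W ⊆ W for every i). Let s > 0 and let μ be a σ-invariant Borel probability measure on Σ_ℓ satisfying the Gibbs property for Φ_𝒜^s with pressure P ∈ ℝ and constant C_0 > 1. Then μ is totally ergodic: for every n ∈ ℕ, μ is ergodic with respect to the map σ^n. -/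

import Mathlib

open Matrix MeasureTheory

/-- For a word `I = [i₀, i₁, …, i_{n-1}]`, the cocycle product
`A_I = A_{i_{n-1}} ⋯ A_{i₀}`. -/
noncomputable def wordProd {ℓ d : ℕ} (A : Fin ℓ → Matrix (Fin d) (Fin d) ℝ)
    (I : List (Fin ℓ)) : Matrix (Fin d) (Fin d) ℝ :=
  I.foldl (fun B i => A i * B) 1

/-- The operator norm of a matrix, viewed as a linear operator on Euclidean space. -/
noncomputable def opNorm {d : ℕ} (M : Matrix (Fin d) (Fin d) ℝ) : ℝ :=
  ‖Matrix.toEuclideanCLM (𝕜 := ℝ) M‖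

/-- The left shift on the full one-sided shift space `Σ_ℓ = {1,…,ℓ}^ℕ`. -/
def shift (ℓ : ℕ) : (ℕ → Fin ℓ) → (ℕ → Fin ℓ) := fun x n => x (n + 1)

/-- The cylinder set `[I]` of sequences starting with the word `I`. -/
def cylinder {ℓ : ℕ} (I : List (Fin ℓ)) : Set (ℕ → Fin ℓ) :=
  {x | ∀ k : Fin I.length, x k = I.get k}

open scoped Pointwise

section
variable {G Ω ι : Type*} [Group G] [MulAction G Ω]

/-- The ordered product `a i_{n-1} ⋯ a i₀` along the word `[i₀, …, i_{n-1}]`. -/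
def revProd {M ι : Type*} [Monoid M] (a : ι → M) (I : List ι) : M := (I.map a).reverse.prod

lemma revProd_append {M ι : Type*} [Monoid M] (a : ι → M) (I J : List ι) :
    revProd a (I ++ J) = revProd a J * revProd a I := by simp [revProd]

lemma revProd_cons {M ι : Type*} [Monoid M] (a : ι → M) (i : ι) (J : List ι) :
    revProd a (i :: J) = revProd a J * a i := by simp [revProd]

lemma revProd_replicate {M ι : Type*} [Monoid M] (a : ι → M) (i : ι) (k : ℕ) :
    revProd a (List.replicate k i) = a i ^ k := by simp [revProd]

lemma map_revProd {M N ι : Type*} [Monoid M] [Monoid N] (f : M →* N) (a : ι → M) (I : List ι) :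
    f (revProd a I) = revProd (f ∘ a) I := by
  simp [revProd, map_list_prod, List.map_reverse]

/-- A point is fixed by every product along a word of length `n`. -/
def FixedByWords (a : ι → G) (n : ℕ) (U : Ω) : Prop :=
  ∀ I : List ι, I.length = n → revProd a I • U = U

lemma FixedByWords.smul_eq {a : ι → G} {n : ℕ} {U : Ω} (hn : 0 < n)
    (h : FixedByWords a n U) (i j : ι) : a j • U = a i • U := by
  obtain ⟨m, rfl⟩ : ∃ m, n = m + 1 := ⟨n - 1, by omega⟩
  have h1 := h (j :: List.replicate m i) (by simp)
  have h2 := h (i :: List.replicate m i) (by simp)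
  rw [revProd_cons, mul_smul] at h1 h2
  exact smul_left_cancel _ (h1.trans h2.symm)

lemma FixedByWords.smul {a : ι → G} {n : ℕ} {U : Ω} (hn : 0 < n)
    (h : FixedByWords a n U) (i : ι) : FixedByWords a n (a i • U) := by
  intro I hI
  rcases I.eq_nil_or_concat' with rfl | ⟨L, j, rfl⟩
  · simp at hI; omega
  · have h1 := h (i :: L) (by simpa using hI)
    rw [revProd_cons, mul_smul] at h1
    rw [revProd_append, mul_smul, h1]
    simpa [revProd] using h.smul_eq hn i j

lemma FixedByWords.pow_smul {a : ι → G} {n : ℕ} {U : Ω} (hn : 0 < n)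
    (h : FixedByWords a n U) (i : ι) (k : ℕ) : FixedByWords a n (a i ^ k • U) := by
  induction k with
  | zero => simpa using h
  | succ k ih => rw [pow_succ', mul_smul]; exact ih.smul hn i

lemma FixedByWords.pow_period_smul {a : ι → G} {n : ℕ} {U : Ω}
    (h : FixedByWords a n U) (i : ι) : a i ^ n • U = U := by
  simpa [revProd_replicate] using h (List.replicate n i) (by simp)

lemma FixedByWords.inv_smul {a : ι → G} {n : ℕ} {U : Ω} (hn : 0 < n)
    (h : FixedByWords a n U) (i : ι) : FixedByWords a n ((a i)⁻¹ • U) := by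
  have : (a i)⁻¹ • U = a i ^ (n - 1) • U := by
    rw [inv_smul_eq_iff, ← mul_smul, ← pow_succ', Nat.sub_add_cancel hn, h.pow_period_smul]
  rw [this]
  exact h.pow_smul hn i _

lemma FixedByWords.revProd_smul {a : ι → G} {n : ℕ} {U : Ω} (hn : 0 < n)
    (h : FixedByWords a n U) (i : ι) (J : List ι) :
    revProd a J • U = a i ^ J.length • U := by
  induction J generalizing U with
  | nil => simp [revProd]
  | cons j J ih =>
    rw [revProd_cons, mul_smul, h.smul_eq hn i j, ih (h.smul hn i), List.length_cons, pow_succ,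
      mul_smul]
end

section
variable {R M : Type*} [Ring R] [AddCommGroup M] [Module R M]
  {σ σ' : R →+* R} [RingHomInvPair σ σ'] [RingHomInvPair σ' σ]

/-- A semilinear automorphism carries isomorphic submodules to isomorphic submodules. -/
lemma nonempty_linearEquiv_map (e : M ≃ₛₗ[σ] M) {N V : Submodule R M}
    (h : Nonempty (N ≃ₗ[R] V)) :
    Nonempty (N.map (e : M →ₛₗ[σ] M) ≃ₗ[R] V.map (e : M →ₛₗ[σ] M)) := by
  obtain ⟨φ⟩ := h
  exact ⟨(e.submoduleMap N).symm.trans (φ.trans (e.submoduleMap V))⟩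

lemma map_isotypicComponent_le (e : M ≃ₛₗ[σ] M) (V : Submodule R M) :
    (isotypicComponent R M V).map (e : M →ₛₗ[σ] M) ≤
      isotypicComponent R M (V.map (e : M →ₛₗ[σ] M)) := by
  rw [Submodule.map_le_iff_le_comap]
  refine sSup_le fun N hN ↦ ?_
  rw [← Submodule.map_le_iff_le_comap]
  exact le_sSup (nonempty_linearEquiv_map e hN)

lemma map_mem_isotypicComponents (e : M ≃ₛₗ[σ] M) {c : Submodule R M}
    (hc : c ∈ isotypicComponents R M) :
    c.map (e : M →ₛₗ[σ] M) ∈ isotypicComponents R M := by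
  obtain ⟨V, hV, rfl⟩ := hc
  refine ⟨V.map (e : M →ₛₗ[σ] M), ?_, le_antisymm (map_isotypicComponent_le e V) ?_⟩
  · rw [isSimpleModule_iff_isAtom] at hV ⊢
    exact ((Submodule.orderIsoMapComap e).isAtom_iff V).2 hV
  · have h := map_isotypicComponent_le e.symm (V.map (e : M →ₛₗ[σ] M))
    have h1 : (V.map (e : M →ₛₗ[σ] M)).map (e.symm : M →ₛₗ[σ'] M) = V := by
      ext x; simp
    rw [h1, Submodule.map_le_iff_le_comap] at h
    intro x hx
    exact ⟨e.symm x, h hx, by simp⟩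

lemma sSupIndep.iSupIndep_of_injective {L ι : Type*} [CompleteLattice L] {s : Set L}
    (hs : sSupIndep s) {f : ι → L} (hf : f.Injective) (h : ∀ i, f i ∈ s) : iSupIndep f := by
  rw [sSupIndep_iff] at hs
  exact hs.comp (f := fun i ↦ (⟨f i, h i⟩ : s)) fun i j hij ↦ hf (congrArg Subtype.val hij)

end

section
variable {k M : Type*} [Field k] [AddCommGroup M] [Module k M] [FiniteDimensional k M]

/-- Let `g` normalize the algebra `S`, with a positive power in `S`, and suppose that for no `t`
dividing the dimension `S` and `g ^ t` have a common nontrivial invariant subspace. Then an element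
of `S` vanishing on a nonzero `S`-invariant subspace is zero: there is only one isotypic component,
since `g` permutes the isotypic components transitively. -/
theorem eq_zero_of_vanish_on_submodule (S : Subalgebra k (Module.End k M))
    (g : (Module.End k M)ˣ)
    (hg : ∀ x ∈ S, (g : Module.End k M) * x * (↑g⁻¹ : Module.End k M) ∈ S)
    (hg' : ∀ x ∈ S, (↑g⁻¹ : Module.End k M) * x * (g : Module.End k M) ∈ S)
    {n : ℕ} (hn : 0 < n) (hgn : ((g ^ n : (Module.End k M)ˣ) : Module.End k M) ∈ S)
    (hirr : ∀ t : ℕ, 0 < t → t ∣ Module.finrank k M → ∀ W : Submodule k M, W ≠ ⊥ →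
      (∀ x ∈ S, W.map x ≤ W) → g ^ t • W ≤ W → W = ⊤)
    {U : Submodule k M} (hU : U ≠ ⊥) (hUS : ∀ x ∈ S, U.map x ≤ U)
    {x : Module.End k M} (hx : x ∈ S) (hxU : ∀ u ∈ U, x u = 0) : x = 0 := by
  let τ : S ≃+* S :=
    { toFun := fun x ↦ ⟨_, hg x.1 x.2⟩
      invFun := fun x ↦ ⟨_, hg' x.1 x.2⟩
      left_inv := fun x ↦ by ext1; simp [mul_assoc]
      right_inv := fun x ↦ by ext1; simp [mul_assoc]
      map_mul' := fun x y ↦ by ext1; simp [mul_assoc]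
      map_add' := fun x y ↦ by ext1; simp [mul_add, add_mul] }
  have := RingHomInvPair.of_ringEquiv τ
  have := RingHomInvPair.symm (τ : S →+* S) (τ.symm : S →+* S)
  let e : M ≃ₛₗ[(τ : S →+* S)] M :=
    { toFun := fun m ↦ (g : Module.End k M) m
      map_add' := by simp
      map_smul' := fun x m ↦ by
        change (g : Module.End k M) (x.1 m) =
          ((g : Module.End k M) * x * (↑g⁻¹ : Module.End k M)) (g.1 m)
        rw [← Module.End.mul_apply, ← Module.End.mul_apply]
        simp [mul_assoc]
      invFun := fun m ↦ (↑g⁻¹ : Module.End k M) m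
      left_inv := fun m ↦ by
        change ((↑g⁻¹ : Module.End k M) * (g : Module.End k M)) m = m
        simp
      right_inv := fun m ↦ by
        change ((g : Module.End k M) * (↑g⁻¹ : Module.End k M)) m = m
        simp }
  have : IsNoetherian S M := isNoetherian_of_tower k inferInstance
  have : IsArtinian S M := isArtinian_of_tower k inferInstance
  have stable (N : Submodule S M) : ∀ x ∈ S,
      (N.restrictScalars k).map x ≤ N.restrictScalars k := by
    rintro x hx _ ⟨m, hm, rfl⟩
    exact N.smul_mem ⟨x, hx⟩ hm
  let U' : Submodule S M :=
    { U with smul_mem' := fun c m hm ↦ hUS c.1 c.2 ⟨m, hm, rfl⟩ }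
  have hU' : U' ≠ ⊥ := by
    contrapose! hU
    rw [eq_bot_iff]
    intro m hm
    have : m ∈ U' := hm
    rw [hU] at this
    simpa using this
  obtain ⟨V, hV, hVU⟩ := (IsAtomic.eq_bot_or_exists_atom_le U').resolve_left hU'
  have hVs : IsSimpleModule S V := isSimpleModule_iff_isAtom.2 hV
  let Φ : Submodule S M → Submodule S M := fun N ↦ N.map (e : M →ₛₗ[(τ : S →+* S)] M)
  set c := isotypicComponent S M V with hc
  have hΦ (N : Submodule S M) : (Φ N).restrictScalars k = g • N.restrictScalars k := by
    ext m
    simp [Φ, Submodule.mem_map, Submodule.mem_smul_pointwise_iff_exists, e, Units.smul_def]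
  have hΦj (j : ℕ) (N : Submodule S M) :
      (Φ^[j] N).restrictScalars k = g ^ j • N.restrictScalars k := by
    induction j with
    | zero => simp
    | succ j ih => rw [Function.iterate_succ_apply', hΦ, ih, pow_succ', mul_smul]
  have finrank_smul (u : (Module.End k M)ˣ) (N : Submodule k M) :
      Module.finrank k (u • N : Submodule k M) = Module.finrank k N :=
    (LinearMap.GeneralLinearGroup.toLinearEquiv u).finrank_map_eq N
  have hmem (j : ℕ) : Φ^[j] c ∈ isotypicComponents S M := by
    induction j with
    | zero => exact ⟨V, hVs, rfl⟩
    | succ j ih =>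
      rw [Function.iterate_succ_apply']
      exact map_mem_isotypicComponents e ih
  have hper : Function.IsPeriodicPt Φ n c := by
    apply Submodule.restrictScalars_injective k S M
    rw [hΦj]
    exact Submodule.eq_of_le_of_finrank_eq (stable c _ hgn) (finrank_smul _ _)
  set r := Function.minimalPeriod Φ c with hr
  have hr0 : 0 < r := hper.minimalPeriod_pos hn
  have hc0 : c.restrictScalars k ≠ ⊥ := by
    rw [Ne, Submodule.restrictScalars_eq_bot_iff]
    exact (bot_lt_isotypicComponents (hmem 0)).ne'
  let F : Fin r → Submodule S M := fun j ↦ Φ^[j] c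
  have hind : iSupIndep F := by
    refine (sSupIndep_isotypicComponents S M).iSupIndep_of_injective (fun i j hij ↦ ?_)
      fun i ↦ hmem i
    exact Fin.ext (Function.iterate_injOn_Iio_minimalPeriod i.2 j.2 hij)
  have hle (j : ℕ) : Φ^[j] c ≤ iSup F := by
    rw [← Function.iterate_mod_minimalPeriod_eq]
    exact le_iSup F ⟨j % r, Nat.mod_lt _ hr0⟩
  have htop : iSup F = ⊤ := by
    rw [← Submodule.restrictScalars_eq_top_iff k]
    refine hirr 1 one_pos (one_dvd _) _ ?_ (stable _) ?_
    · intro h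
      rw [Submodule.restrictScalars_eq_bot_iff] at h
      have := hle 0
      rw [h, le_bot_iff] at this
      exact hc0 (by simpa using this)
    · rw [pow_one, ← hΦ]
      change Φ (iSup F) ≤ iSup F
      simp only [Φ, Submodule.map_iSup, iSup_le_iff]
      intro j
      have := hle (j + 1)
      rwa [Function.iterate_succ_apply'] at this
  have hdim : r ∣ Module.finrank k M := by
    have hint := DirectSum.isInternal_submodule_of_iSupIndep_of_iSup_eq_top hind htop
    let E := (LinearEquiv.ofBijective (DirectSum.coeLinearMap F) hint).restrictScalars k
    have (i : Fin r) : Module.Finite k (F i) :=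
      inferInstanceAs (Module.Finite k ((F i).restrictScalars k))
    have (i : Fin r) : Module.Free k (F i) :=
      inferInstanceAs (Module.Free k ((F i).restrictScalars k))
    have hF (i : Fin r) : Module.finrank k (F i) = Module.finrank k (c.restrictScalars k) := by
      rw [← finrank_smul (g ^ (i : ℕ)), ← hΦj]
      rfl
    rw [← E.finrank_eq, Module.finrank_directSum]
    simp [hF]
  have hctop : c = ⊤ := by
    rw [← Submodule.restrictScalars_eq_top_iff k]
    refine hirr r hr0 hdim _ hc0 (stable c) ?_
    rw [← hΦj, hr, Function.iterate_minimalPeriod]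
  ext m
  have hm : m ∈ c := hctop ▸ Submodule.mem_top
  rw [hc, isotypicComponent, sSup_eq_iSup'] at hm
  refine Submodule.iSup_induction _ (motive := fun m ↦ x m = 0) hm ?_ (map_zero _) ?_
  · rintro ⟨N, ⟨φ⟩⟩ m hm
    have h := (φ ⟨m, hm⟩).2
    have h0 : (⟨x, hx⟩ : S) • φ ⟨m, hm⟩ = 0 := Subtype.ext (hxU _ (hVU h))
    rw [← map_smul, LinearEquiv.map_eq_zero_iff] at h0
    exact congrArg Subtype.val h0
  · intro y z hy hz
    rw [map_add, hy, hz, add_zero]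
end

section
variable {k M ι : Type*} [Field k] [AddCommGroup M] [Module k M]

/-- The endomorphisms preserving every subspace fixed by all products along words of length `n`. -/
def wordAlgebra (a : ι → (Module.End k M)ˣ) (n : ℕ) : Subalgebra k (Module.End k M) where
  carrier := {x | ∀ U : Submodule k M, FixedByWords a n U → ∀ u ∈ U, x u ∈ U}
  mul_mem' hx hy U hU u hu := hx U hU _ (hy U hU u hu)
  add_mem' hx hy U hU u hu := U.add_mem (hx U hU u hu) (hy U hU u hu)
  algebraMap_mem' c U _ u hu := by simpa using U.smul_mem c hu

lemma units_mem_wordAlgebra {a : ι → (Module.End k M)ˣ} {n : ℕ} {x : (Module.End k M)ˣ}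
    (hx : ∀ U : Submodule k M, FixedByWords a n U → x • U = U) :
    (x : Module.End k M) ∈ wordAlgebra a n := by
  intro U hU u hu
  exact (hx U hU).le (Submodule.smul_mem_pointwise_smul u x U hu)

lemma inv_pow_mul_revProd_mem_wordAlgebra (a : ι → (Module.End k M)ˣ) {n : ℕ} (hn : 0 < n)
    (i : ι) (J : List ι) :
    (((a i ^ (J.length % n))⁻¹ * revProd a J : (Module.End k M)ˣ) : Module.End k M) ∈
      wordAlgebra a n := by
  refine units_mem_wordAlgebra fun U hU ↦ ?_
  rw [mul_smul, hU.revProd_smul hn i, inv_smul_eq_iff]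
  nth_rewrite 1 [← Nat.mod_add_div J.length n]
  rw [pow_add, mul_smul, pow_mul]
  congr 1
  exact smul_eq_iff_eq_inv_smul _ |>.2 (by
    induction J.length / n with
    | zero => simp
    | succ m ih =>
      rw [pow_succ, _root_.mul_inv_rev, mul_smul, ← ih, eq_inv_smul_iff, hU.pow_period_smul])

variable [FiniteDimensional k M]

lemma units_smul_eq_of_le {u : (Module.End k M)ˣ} {U : Submodule k M} (h : u • U ≤ U) :
    u • U = U :=
  Submodule.eq_of_le_of_finrank_eq h
    ((LinearMap.GeneralLinearGroup.toLinearEquiv u).finrank_map_eq U)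

/-- A nonzero operator in `g ^ q` times the word algebra cannot annihilate the whole orbit of a
nonzero vector under words of length divisible by `n`. -/
theorem exists_word_apply_ne_zero (a : ι → (Module.End k M)ˣ) {n : ℕ} (hn : 0 < n) (i : ι)
    (hirr : ∀ t : ℕ, 0 < t → t ∣ Module.finrank k M → ∀ W : Submodule k M, W ≠ ⊥ →
      (∀ I : List ι, I.length = t → revProd a I • W ≤ W) → W = ⊤)
    {X : Module.End k M} (hX : X ≠ 0) {q : ℕ}
    (hXq : (((a i ^ q)⁻¹ : (Module.End k M)ˣ) : Module.End k M) * X ∈ wordAlgebra a n)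
    {v : M} (hv : v ≠ 0) :
    ∃ K : List ι, n ∣ K.length ∧ X ((revProd a K).1 v) ≠ 0 := by
  by_contra! hcon
  let T : Set M := {w | ∃ K : List ι, n ∣ K.length ∧ w = (revProd a K).1 v}
  have hvT : v ∈ T := ⟨[], by simp, by simp [revProd]⟩
  have hU : FixedByWords a n (Submodule.span k T) := by
    intro I hI
    apply units_smul_eq_of_le
    change (Submodule.span k T).map _ ≤ _
    rw [Submodule.map_span, Submodule.span_le]
    rintro _ ⟨_, ⟨K, hK, rfl⟩, rfl⟩
    refine Submodule.subset_span ⟨K ++ I, by simpa [hI] using hK, ?_⟩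
    rw [revProd_append]
    rfl
  have hzero : ∀ u ∈ Submodule.span k T, X u = 0 := by
    intro u hu
    induction hu using Submodule.span_induction with
    | mem x hx => obtain ⟨K, hK, rfl⟩ := hx; exact hcon K hK
    | zero => simp
    | add x y _ _ hx hy => simp [hx, hy]
    | smul c x _ hx => simp [hx]
  have key := eq_zero_of_vanish_on_submodule (wordAlgebra a n) (a i) ?_ ?_ hn ?_ ?_
    (U := Submodule.span k T) ?_ ?_ hXq ?_
  · exact hX ((Units.mul_right_eq_zero _).1 key)
  · intro x hx U hU u hu
    have h1 : (a i)⁻¹ • u ∈ (a i)⁻¹ • U := Submodule.smul_mem_pointwise_smul _ _ _ hu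
    have h2 := hx _ (hU.inv_smul hn i) _ h1
    have h3 := Submodule.smul_mem_pointwise_smul _ (a i) _ h2
    exact (smul_inv_smul (a i) U).le h3
  · intro x hx U hU u hu
    have h1 : (a i) • u ∈ (a i) • U := Submodule.smul_mem_pointwise_smul _ _ _ hu
    have h2 := hx _ (hU.smul hn i) _ h1
    have h3 := Submodule.smul_mem_pointwise_smul _ (a i)⁻¹ _ h2
    exact (inv_smul_smul (a i) U).le h3
  · exact units_mem_wordAlgebra fun U hU ↦ hU.pow_period_smul i
  · intro t ht htd W hW hWS hWt
    have hWfix : FixedByWords a n W := by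
      intro I hI
      apply units_smul_eq_of_le
      exact hWS _ (units_mem_wordAlgebra fun U hU ↦ hU I hI)
    refine hirr t ht htd W hW fun I hI ↦ ?_
    rwa [hWfix.revProd_smul hn i, hI]
  · exact fun h ↦ hv (by simpa [h] using Submodule.subset_span (R := k) hvT)
  · rintro x hx _ ⟨u, hu, rfl⟩
    exact hx _ hU u hu
  · intro u hu
    simp [hzero u hu]
end

/-- Norms of products are quasi-multiplicative, with connecting words of length divisible by `n`. -/
theorem exists_finset_quasimultiplicative {E ι : Type*} [NormedAddCommGroup E] [NormedSpace ℝ E]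
    [FiniteDimensional ℝ E] [Nontrivial E] (i : ι) (a : ι → (E →L[ℝ] E)ˣ) {n : ℕ} (hn : 0 < n)
    (hirr : ∀ t : ℕ, 0 < t → t ∣ Module.finrank ℝ E → ∀ W : Submodule ℝ E, W ≠ ⊥ →
      (∀ I : List ι, I.length = t → W.map ((revProd a I).1 : E →ₗ[ℝ] E) ≤ W) → W = ⊤) :
    ∃ c > 0, ∃ F : Finset (List ι), (∀ K ∈ F, n ∣ K.length) ∧ ∀ I J : List ι, ∃ K ∈ F,
      c * (‖(revProd a J).1‖ * ‖(revProd a I).1‖) ≤ ‖(revProd a (I ++ K ++ J)).1‖ := by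
  let φ : (E →L[ℝ] E) →* Module.End ℝ E :=
    (ContinuousLinearMap.toLinearMapRingHom : (E →L[ℝ] E) →+* (E →ₗ[ℝ] E)).toMonoidHom
  let b : ι → (Module.End ℝ E)ˣ := Units.map φ ∘ a
  have hb (I : List ι) : (revProd b I).1 = ((revProd a I).1 : E →ₗ[ℝ] E) := by
    rw [← map_revProd]; rfl
  let C (q : ℕ) : Submodule ℝ (E →L[ℝ] E) :=
    (Subalgebra.toSubmodule (wordAlgebra b n)).comap
      ((LinearMap.mulLeft ℝ ((b i ^ q)⁻¹).1).comp (ContinuousLinearMap.coeLM ℝ))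
  let Z : Set (E →L[ℝ] E) := Metric.sphere 0 1 ∩ ⋃ q ∈ Finset.range n, (C q : Set (E →L[ℝ] E))
  have hZ : IsCompact Z := by
    have : ProperSpace (E →L[ℝ] E) := FiniteDimensional.proper ℝ _
    exact (isCompact_sphere _ _).inter_right
      (isClosed_biUnion_finset fun q _ ↦ (C q).closed_of_finiteDimensional)
  have : ProperSpace E := FiniteDimensional.proper ℝ _
  have hcpt : IsCompact (Z ×ˢ Metric.sphere (0 : E) 1) := hZ.prod (isCompact_sphere _ _)
  have hcont (K : List ι) :
      Continuous fun p : (E →L[ℝ] E) × E ↦ p.1 ((revProd a K).1 p.2) := by fun_prop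
  obtain ⟨F, hF⟩ := hcpt.elim_finite_subcover
    (fun K : {K : List ι // n ∣ K.length} ↦ {p | p.1 ((revProd a K.1).1 p.2) ≠ 0})
    (fun K ↦ isOpen_ne_fun (hcont K) continuous_const) (by
      rintro ⟨X, v⟩ ⟨⟨hX1, hXC⟩, hv⟩
      simp only [Set.mem_iUnion, Finset.mem_range] at hXC
      obtain ⟨q, -, hXq⟩ := hXC
      obtain ⟨K, hK, hne⟩ := exists_word_apply_ne_zero b hn i
        (fun t ht htd W hW hWS ↦ hirr t ht htd W hW fun I hI ↦ by
          rw [← hb]; exact hWS I hI)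
        (X := (X : E →ₗ[ℝ] E))
        (by
          rintro h
          have : X = 0 := by ext v; exact LinearMap.congr_fun h v
          simp [this] at hX1)
        hXq (v := v) (by rintro rfl; simp at hv)
      rw [hb] at hne
      exact Set.mem_iUnion.2 ⟨⟨K, hK⟩, hne⟩)
  obtain ⟨m, hm0, hm⟩ := hcpt.exists_forall_le'
    (f := fun p ↦ ∑ K ∈ F, ‖p.1 ((revProd a K.1).1 p.2)‖) (a := 0)
    (by fun_prop) (by
      intro p hp
      obtain ⟨K, hK, hne⟩ : ∃ K ∈ F, p.1 ((revProd a K.1).1 p.2) ≠ 0 := by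
        simpa using hF hp
      exact Finset.sum_pos' (fun _ _ ↦ norm_nonneg _) ⟨K, hK, norm_pos_iff.2 hne⟩)
  have hpos (I : List ι) : 0 < ‖(revProd a I).1‖ := norm_pos_iff.2 (Units.ne_zero _)
  refine ⟨m / (2 * (F.card + 1)), by positivity, F.map (Function.Embedding.subtype _), ?_, ?_⟩
  · intro K hK
    simp only [Finset.mem_map, Function.Embedding.subtype_apply] at hK
    obtain ⟨K, -, rfl⟩ := hK
    exact K.2
  intro I J
  by_contra! hcon
  obtain ⟨u, hu, hIu⟩ : ∃ u : E, ‖u‖ ≤ 1 ∧ ‖(revProd a I).1‖ / 2 < ‖(revProd a I).1 u‖ := by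
    obtain ⟨u, hu, h⟩ := (revProd a I).1.exists_lt_apply_of_lt_opNorm (half_lt_self (hpos I))
    exact ⟨u, hu.le, h⟩
  set w := (revProd a I).1 u with hw
  have hw0 : 0 < ‖w‖ := lt_trans (half_pos (hpos I)) hIu
  set x := ‖(revProd a J).1‖ with hx
  have hx0 : 0 < x := hpos J
  have key := hm (x⁻¹ • (revProd a J).1, ‖w‖⁻¹ • w) (by
    refine ⟨⟨?_, ?_⟩, ?_⟩
    · simp [norm_smul, ← hx, abs_of_pos hx0, hx0.ne']
    · simp only [Set.mem_iUnion, Finset.mem_range]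
      refine ⟨J.length % n, Nat.mod_lt _ hn, (C _).smul_mem _ ?_⟩
      have := inv_pow_mul_revProd_mem_wordAlgebra b hn i J
      rwa [Units.val_mul, hb] at this
    · simp [norm_smul, hw0.ne'])
  have hterm : ∀ K ∈ F, ‖(x⁻¹ • (revProd a J).1) ((revProd a K.1).1 (‖w‖⁻¹ • w))‖ ≤
      m / (F.card + 1) := by
    intro K hK
    have h1 := (hcon K.1 (Finset.mem_map_of_mem _ hK)).le
    have h2 : ‖(revProd a J).1 ((revProd a K.1).1 w)‖ ≤ ‖(revProd a (I ++ K ++ J)).1‖ := by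
      have h := (revProd a (I ++ K ++ J)).1.le_of_opNorm_le le_rfl u
      rw [revProd_append, revProd_append] at h ⊢
      exact h.trans (mul_le_of_le_one_right (norm_nonneg _) hu)
    have h3 : ‖(x⁻¹ • (revProd a J).1) ((revProd a K.1).1 (‖w‖⁻¹ • w))‖ =
        x⁻¹ * (‖w‖⁻¹ * ‖(revProd a J).1 ((revProd a K.1).1 w)‖) := by
      simp only [map_smul, _root_.smul_apply, norm_smul, norm_inv, norm_norm,
        Real.norm_of_nonneg hx0.le]
      ring
    rw [h3, ← mul_assoc, ← mul_inv, inv_mul_le_iff₀ (by positivity)]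
    refine (h2.trans h1).trans ?_
    have h4 : m / (F.card + 1) * x * (‖(revProd a I).1‖ / 2) ≤ m / (F.card + 1) * x * ‖w‖ := by
      gcongr
    calc _ = m / (F.card + 1) * x * (‖(revProd a I).1‖ / 2) := by field_simp
      _ ≤ _ := h4
      _ = _ := by ring
  have hsum := key.trans (Finset.sum_le_card_nsmul F _ _ hterm)
  rw [nsmul_eq_mul, mul_div_assoc', le_div_iff₀ (by positivity)] at hsum
  nlinarith

section
open scoped ENNReal

lemma measurable_shift (ℓ : ℕ) : Measurable (shift ℓ) :=
  measurable_pi_lambda _ fun n ↦ measurable_pi_apply (n + 1)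

lemma shift_iterate_apply (ℓ : ℕ) (m : ℕ) (x : ℕ → Fin ℓ) (j : ℕ) :
    (shift ℓ)^[m] x j = x (j + m) := by
  induction m generalizing x with
  | zero => rfl
  | succ m ih => rw [Function.iterate_succ_apply, ih]; simp [shift, add_assoc]

lemma cylinder_append_subset {ℓ : ℕ} (I J : List (Fin ℓ)) :
    cylinder (I ++ J) ⊆ cylinder I ∩ (shift ℓ)^[I.length] ⁻¹' cylinder J := by
  intro x hx
  refine ⟨fun k ↦ ?_, fun k ↦ ?_⟩
  · have := hx ⟨k, by simp; omega⟩
    simpa using this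
  · have := hx ⟨k + I.length, by simp; omega⟩
    simpa [shift_iterate_apply] using this

lemma cylinder_eq_preimage {ℓ : ℕ} (I : List (Fin ℓ)) :
    cylinder I = (fun (x : ℕ → Fin ℓ) (k : Fin I.length) ↦ x k) ⁻¹' {I.get} := by
  ext x; simp [_root_.cylinder, funext_iff]

lemma measurableSet_cylinder {ℓ : ℕ} (I : List (Fin ℓ)) : MeasurableSet (cylinder I) := by
  rw [cylinder_eq_preimage]
  exact measurableSet_preimage (by fun_prop) (measurableSet_singleton _)

/-- Finite measures on the shift space compare as soon as they compare on cylinders whose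
length is a multiple of `n`. -/
lemma measure_le_of_cylinder_le {ℓ n : ℕ} (hn : 0 < n) (α β : Measure (ℕ → Fin ℓ))
    [IsFiniteMeasure β]
    (h : ∀ I : List (Fin ℓ), n ∣ I.length → α (cylinder I) ≤ β (cylinder I)) : α ≤ β := by
  have hopen (U : Set (ℕ → Fin ℓ)) (hU : IsOpen U) : α U ≤ β U := by
    let T (k : ℕ) : Set (List (Fin ℓ)) := {I | I.length = n * k ∧ cylinder I ⊆ U}
    let V (k : ℕ) : Set (ℕ → Fin ℓ) := ⋃ I ∈ T k, cylinder I
    have hV : U = ⋃ k, V k := by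
      refine Set.Subset.antisymm (fun x hx ↦ ?_) (Set.iUnion_subset fun k ↦
        Set.iUnion₂_subset fun I hI ↦ hI.2)
      obtain ⟨s, u, hu, hsu⟩ := isOpen_pi_iff.1 hU x hx
      obtain ⟨N, hN⟩ := s.exists_nat_subset_range
      refine Set.mem_iUnion.2 ⟨N, Set.mem_iUnion₂.2 ⟨List.ofFn fun j : Fin (n * N) ↦ x j,
        ⟨by simp, fun y hy ↦ hsu fun j hj ↦ ?_⟩, fun k ↦ by simp⟩⟩
      have hjN : j < n * N := (Finset.mem_range.1 (hN hj)).trans_le (Nat.le_mul_of_pos_left N hn)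
      have := hy ⟨j, by simpa using hjN⟩
      simp only [List.get_ofFn] at this
      simpa [this] using (hu j hj).2
    have hmono : Monotone V := by
      refine monotone_nat_of_le_succ fun k x hx ↦ ?_
      obtain ⟨I, ⟨hI, hIU⟩, hxI⟩ := Set.mem_iUnion₂.1 hx
      refine Set.mem_iUnion₂.2 ⟨I ++ List.ofFn fun j : Fin n ↦ x (I.length + j),
        ⟨by simp [hI, mul_add], fun y hy ↦ hIU (cylinder_append_subset _ _ hy).1⟩, fun j ↦ ?_⟩
      rcases lt_or_ge j.1 I.length with hj | hj
      · simpa [List.getElem_append_left, hj] using hxI ⟨j, hj⟩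
      · simp [List.getElem_append_right, hj]
    have hle (k : ℕ) : α (V k) ≤ β (V k) := by
      have hfin : (T k).Finite := (List.finite_length_eq (Fin ℓ) (n * k)).subset fun I hI ↦ hI.1
      have hdisj : (T k).PairwiseDisjoint cylinder := by
        intro I hI J hJ hIJ
        refine Set.disjoint_left.2 fun x hxI hxJ ↦ hIJ ?_
        refine List.ext_getElem (hI.1.trans hJ.1.symm) fun j h1 h2 ↦ ?_
        exact (hxI ⟨j, h1⟩).symm.trans (hxJ ⟨j, h2⟩)
      calc α (V k) = ∑' I : T k, α (cylinder I.1) :=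
            measure_biUnion hfin.countable hdisj fun I _ ↦ measurableSet_cylinder I
        _ ≤ ∑' I : T k, β (cylinder I.1) :=
            ENNReal.tsum_le_tsum fun I ↦ h I.1 ⟨k, I.2.1⟩
        _ = β (V k) :=
            (measure_biUnion hfin.countable hdisj fun I _ ↦ measurableSet_cylinder I).symm
    rw [hV, hmono.measure_iUnion, hmono.measure_iUnion]
    exact iSup_mono hle
  let _ := TopologicalSpace.metrizableSpaceMetric (ℕ → Fin ℓ)
  intro s
  rw [Set.measure_eq_iInf_isOpen s β]
  exact le_iInf₂ fun U hsU ↦ le_iInf fun hU ↦ (measure_mono hsU).trans (hopen U hU)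

/-- A shift-invariant measure with a lower quasi-Bernoulli property along connecting words of length
divisible by `n` is ergodic for the `n`-th iterate of the shift. -/
theorem ergodic_iterate_shift_of_quasi_bernoulli {ℓ n : ℕ} (hn : 0 < n)
    (μ : Measure (ℕ → Fin ℓ)) [IsProbabilityMeasure μ]
    (hinv : MeasurePreserving (shift ℓ) μ μ) (F : Finset (List (Fin ℓ)))
    (hF : ∀ K ∈ F, n ∣ K.length) {c : ℝ≥0∞} (hc0 : c ≠ 0)
    (h : ∀ I J : List (Fin ℓ), ∃ K ∈ F,
      c * (μ (cylinder I) * μ (cylinder J)) ≤ μ (cylinder (I ++ K ++ J))) :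
    Ergodic ((shift ℓ)^[n]) μ := by
  refine ⟨hinv.iterate n, ⟨fun E hE hEinv ↦ ?_⟩⟩
  have hmeas (k : ℕ) : Measurable ((shift ℓ)^[k]) := (measurable_shift ℓ).iterate k
  have hEmul (k : ℕ) (hk : n ∣ k) : (shift ℓ)^[k] ⁻¹' E = E := by
    obtain ⟨m, rfl⟩ := hk
    rw [Function.iterate_mul]
    exact Set.preimage_iterate_eq.symm ▸ Function.IsFixedPt.iterate hEinv m
  have hI (I : List (Fin ℓ)) :
      (c * μ (cylinder I)) • μ ≤
        ∑ K ∈ F, (μ.restrict (cylinder I)).map ((shift ℓ)^[I.length + K.length]) := by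
    refine measure_le_of_cylinder_le one_pos _ _ fun J _ ↦ ?_
    obtain ⟨K, hK, hle⟩ := h I J
    rw [Measure.smul_apply, smul_eq_mul, mul_assoc, Measure.finsetSum_apply]
    refine hle.trans (le_trans ?_ (Finset.single_le_sum (fun _ _ ↦ zero_le) hK))
    rw [Measure.map_apply (hmeas _) (measurableSet_cylinder J),
      Measure.restrict_apply (hmeas _ (measurableSet_cylinder J))]
    refine measure_mono fun x hx ↦ ?_
    have h1 := cylinder_append_subset _ _ hx
    exact ⟨by simpa using h1.2, (cylinder_append_subset _ _ h1.1).1⟩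
  have hD : (c * μ E) • μ ≤ (F.card : ℝ≥0∞) • μ.restrict E := by
    have : IsFiniteMeasure ((F.card : ℝ≥0∞) • μ.restrict E) :=
      Measure.smul_finite _ (by simp)
    refine measure_le_of_cylinder_le hn _ _ fun I hIn ↦ ?_
    have h1 := hI I E
    rw [Measure.finsetSum_apply, Finset.sum_congr rfl fun K hK ↦ by
      rw [Measure.map_apply (hmeas _) hE, hEmul _ (dvd_add hIn (hF K hK)),
        Measure.restrict_apply hE]] at h1
    simp only [Measure.smul_apply, smul_eq_mul, Finset.sum_const, nsmul_eq_mul] at h1 ⊢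
    rw [Measure.restrict_apply (measurableSet_cylinder I), Set.inter_comm]
    calc _ = c * μ (cylinder I) * μ E := by ring
      _ ≤ _ := h1
  have h2 := hD Eᶜ
  simp only [Measure.smul_apply, smul_eq_mul, Measure.restrict_apply hE.compl,
    Set.compl_inter_self, measure_empty, mul_zero, nonpos_iff_eq_zero, mul_eq_zero, hc0,
    false_or] at h2
  rw [Filter.eventuallyConst_set']
  rcases h2 with h2 | h2
  · exact Or.inl (ae_eq_empty.2 h2)
  · exact Or.inr (ae_eq_univ.2 h2)
end

lemma wordProd_eq_revProd {ℓ d : ℕ} (A : Fin ℓ → Matrix (Fin d) (Fin d) ℝ) (I : List (Fin ℓ)) :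
    wordProd A I = revProd A I := by
  have h (B : Matrix (Fin d) (Fin d) ℝ) :
      I.foldl (fun B i => A i * B) B = revProd A I * B := by
    induction I generalizing B with
    | nil => simp [revProd]
    | cons i I ih => rw [List.foldl_cons, ih, revProd_cons, Matrix.mul_assoc]
  simpa [wordProd] using h 1

theorem exists_finset_opNorm_quasimultiplicative {ℓ d : ℕ} (i : Fin ℓ) (hd : 1 ≤ d)
    (A : Fin ℓ → Matrix (Fin d) (Fin d) ℝ) (hA : ∀ i, IsUnit (A i))
    (hirr : ∀ t : ℕ, 0 < t → t ∣ d →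
      ¬ ∃ V : Submodule ℝ (Fin d → ℝ), V ≠ ⊥ ∧ V ≠ ⊤ ∧
        ∀ I : List (Fin ℓ), I.length = t → V.map (wordProd A I).mulVecLin ≤ V)
    {n : ℕ} (hn : 0 < n) :
    ∃ c > 0, ∃ F : Finset (List (Fin ℓ)), (∀ K ∈ F, n ∣ K.length) ∧ ∀ I J : List (Fin ℓ), ∃ K ∈ F,
      c * (opNorm (wordProd A J) * opNorm (wordProd A I)) ≤ opNorm (wordProd A (I ++ K ++ J)) := by
  let f : Matrix (Fin d) (Fin d) ℝ →*
      (EuclideanSpace ℝ (Fin d) →L[ℝ] EuclideanSpace ℝ (Fin d)) :=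
    (Matrix.toEuclideanCLM (n := Fin d) (𝕜 := ℝ) : _ →* _)
  let a : Fin ℓ → (EuclideanSpace ℝ (Fin d) →L[ℝ] EuclideanSpace ℝ (Fin d))ˣ :=
    fun i ↦ Units.map f (hA i).unit
  have ha (I : List (Fin ℓ)) : (revProd a I).1 = Matrix.toEuclideanCLM (𝕜 := ℝ) (wordProd A I) := by
    rw [wordProd_eq_revProd]
    change Units.coeHom _ (revProd a I) = f (revProd A I)
    rw [map_revProd, map_revProd]
    rfl
  have : Nontrivial (EuclideanSpace ℝ (Fin d)) :=
    Module.nontrivial_of_finrank_pos (R := ℝ) (by rw [finrank_euclideanSpace_fin]; omega)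
  obtain ⟨c, hc, F, hF, h⟩ := exists_finset_quasimultiplicative i a hn (by
    intro t ht htd W hW hWS
    by_contra hne
    rw [finrank_euclideanSpace_fin] at htd
    let L := WithLp.linearEquiv 2 ℝ (Fin d → ℝ)
    refine hirr t ht htd ⟨W.map (L : _ →ₗ[ℝ] _), ?_, ?_, fun I hI ↦ ?_⟩
    · rwa [Ne, Submodule.map_eq_bot_iff]
    · intro h
      apply hne
      rw [eq_top_iff]
      intro x _
      have hx : L x ∈ W.map (L : _ →ₗ[ℝ] _) := h ▸ Submodule.mem_top
      obtain ⟨y, hy, hyx⟩ := hx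
      exact L.injective hyx ▸ hy
    · rintro _ ⟨_, ⟨x, hx, rfl⟩, rfl⟩
      refine ⟨_, hWS I hI ⟨x, hx, rfl⟩, ?_⟩
      rw [ha]
      rfl)
  refine ⟨c, hc, F, hF, fun I J ↦ ?_⟩
  obtain ⟨K, hK, hle⟩ := h I J
  rw [ha, ha, ha] at hle
  exact ⟨K, hK, hle⟩

lemma exists_pos_le_of_finset {α : Type*} (F : Finset α) (f : α → ℝ) (hf : ∀ x, 0 < f x) :
    ∃ c > 0, ∀ x ∈ F, c ≤ f x := by
  rcases F.eq_empty_or_nonempty with rfl | hF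
  · exact ⟨1, one_pos, by simp⟩
  · obtain ⟨y, -, hy⟩ := F.exists_min_image f hF
    exact ⟨f y, hf y, hy⟩

theorem gibbs_totally_ergodic
    (ℓ d : ℕ) (hℓ : 2 ≤ ℓ) (hd : 1 ≤ d)
    (A : Fin ℓ → Matrix (Fin d) (Fin d) ℝ) (hA : ∀ i, IsUnit (A i))
    (hirr : ∀ t : ℕ, 0 < t → t ∣ d →
      ¬ ∃ V : Submodule ℝ (Fin d → ℝ), V ≠ ⊥ ∧ V ≠ ⊤ ∧
        ∀ I : List (Fin ℓ), I.length = t → V.map (wordProd A I).mulVecLin ≤ V)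
    (hext : ∀ m : ℕ, 1 ≤ m → m ≤ d - 1 →
      ¬ ∃ W : Submodule ℝ (ExteriorAlgebra ℝ (Fin d → ℝ)),
        W ≤ ⋀[ℝ]^m (Fin d → ℝ) ∧ W ≠ ⊥ ∧ W ≠ ⋀[ℝ]^m (Fin d → ℝ) ∧
        ∀ i : Fin ℓ, W.map (ExteriorAlgebra.map (A i).mulVecLin).toLinearMap ≤ W)
    (s : ℝ) (hs : 0 < s)
    (μ : Measure (ℕ → Fin ℓ)) [IsProbabilityMeasure μ]
    (hinv : MeasurePreserving (shift ℓ) μ μ)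
    (P : ℝ) (C₀ : ℝ) (hC₀ : 1 < C₀)
    (hGibbs : ∀ I : List (Fin ℓ),
      C₀⁻¹ * opNorm (wordProd A I) ^ s ≤ Real.exp (I.length * P) * (μ (cylinder I)).toReal ∧
      Real.exp (I.length * P) * (μ (cylinder I)).toReal ≤ C₀ * opNorm (wordProd A I) ^ s) :
    ∀ n : ℕ, 0 < n → Ergodic ((shift ℓ)^[n]) μ := by
  intro n hn
  obtain ⟨c, hc, F, hF, h⟩ :=
    exists_finset_opNorm_quasimultiplicative ⟨0, by omega⟩ hd A hA hirr hn
  have hC : 0 < C₀ := one_pos.trans hC₀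
  obtain ⟨c', hc', hcF⟩ := exists_pos_le_of_finset F
    (fun K ↦ C₀⁻¹ ^ 3 * c ^ s * Real.exp (-(K.length * P))) (fun K ↦ by positivity)
  refine ergodic_iterate_shift_of_quasi_bernoulli hn μ hinv F hF
    (c := ENNReal.ofReal c') (by simpa using hc') fun I J ↦ ?_
  obtain ⟨K, hK, hle⟩ := h I J
  refine ⟨K, hK, ?_⟩
  rw [← ENNReal.toReal_le_toReal (by finiteness) (by finiteness), ENNReal.toReal_mul,
    ENNReal.toReal_mul, ENNReal.toReal_ofReal hc'.le]
  have hIG := (hGibbs I).2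
  have hJG := (hGibbs J).2
  have hIKJ := (hGibbs (I ++ K ++ J)).1
  have hcK := hcF K hK
  have nonneg (L : List (Fin ℓ)) : 0 ≤ opNorm (wordProd A L) := norm_nonneg _
  have hpow := Real.rpow_le_rpow
    (mul_nonneg hc.le (mul_nonneg (nonneg J) (nonneg I))) hle hs.le
  rw [Real.mul_rpow hc.le (mul_nonneg (nonneg J) (nonneg I)),
    Real.mul_rpow (nonneg J) (nonneg I)] at hpow
  have hexp : Real.exp (((I ++ K ++ J).length : ℕ) * P) =
      Real.exp (I.length * P) * Real.exp (K.length * P) * Real.exp (J.length * P) := by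
    rw [← Real.exp_add, ← Real.exp_add]
    congr 1
    simp only [List.length_append]
    push_cast
    ring
  rw [hexp] at hIKJ
  rw [Real.exp_neg] at hcK
  set eI := Real.exp (I.length * P)
  set eJ := Real.exp (J.length * P)
  set eK := Real.exp (K.length * P)
  have heI : 0 < eI := Real.exp_pos _
  have heJ : 0 < eJ := Real.exp_pos _
  have heK : 0 < eK := Real.exp_pos _
  have hcs : 0 < c ^ s := Real.rpow_pos_of_pos hc s
  set mI := (μ (cylinder I)).toReal
  set mJ := (μ (cylinder J)).toReal
  have hmI : 0 ≤ mI := ENNReal.toReal_nonneg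
  have hmJ : 0 ≤ mJ := ENNReal.toReal_nonneg
  have h1 : eI * mI * (eJ * mJ) ≤
      C₀ * opNorm (wordProd A I) ^ s * (C₀ * opNorm (wordProd A J) ^ s) :=
    mul_le_mul hIG hJG (by positivity) ((by positivity : 0 ≤ eI * mI).trans hIG)
  refine le_of_mul_le_mul_left ?_ (mul_pos (mul_pos heI heK) heJ)
  calc eI * eK * eJ * (c' * (mI * mJ))
      ≤ eI * eK * eJ * (C₀⁻¹ ^ 3 * c ^ s * eK⁻¹ * (mI * mJ)) := by gcongr
    _ = C₀⁻¹ ^ 3 * c ^ s * (eI * mI * (eJ * mJ)) := by field_simp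
    _ ≤ C₀⁻¹ ^ 3 * c ^ s *
        (C₀ * opNorm (wordProd A I) ^ s * (C₀ * opNorm (wordProd A J) ^ s)) := by gcongr
    _ = C₀⁻¹ * (c ^ s * (opNorm (wordProd A J) ^ s * opNorm (wordProd A I) ^ s)) := by
        field_simp
    _ ≤ C₀⁻¹ * opNorm (wordProd A (I ++ K ++ J)) ^ s := by gcongr
    _ ≤ _ := hIKJ
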